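/- Let μ = (μ_1,…,μ_{n/2}) be the random vector with joint density Z_n^{-1}|Δ(μ)|² e^{−Σ_{j=1}^{n/2} μ_j²/2} on Σ_n, and γ_n ∈ X the associated random element. Then the sequence (γ_n)_{n even} is exponentially tight at speed n²/4: for every E > 0 there exists a compact set K_E ⊆ X (one may take K_E = {x ∈ X : x_0 ≤ 2(E+1)}) such that limsup_{n→∞, n even} (4/n²) ln P(γ_n ∉ K_E) < −E. -/

import Mathlib

open MeasureTheory BoundedContinuousFunction Filter

noncomputable section

/-- Membership in the space `X ⊆ l^∞`: `x_j ≥ x_{j+1} ≥ 0` for `j ≥ 1` and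
`Σ_{j=1}^∞ x_j² ≤ x_0` (the series being summable). Bounded sequences are modeled as
bounded (continuous) functions `ℕ →ᵇ ℝ`, whose distance is the sup metric `d`. -/
def memX (x : ℕ →ᵇ ℝ) : Prop :=
  (∀ j : ℕ, 1 ≤ j → 0 ≤ x (j + 1) ∧ x (j + 1) ≤ x j) ∧
  Summable (fun j : ℕ => (x (j + 1)) ^ 2) ∧ (∑' j : ℕ, (x (j + 1)) ^ 2) ≤ x 0

def setX : Set (ℕ →ᵇ ℝ) := {x | memX x}

/-- `J(x) = x_0 − Σ_{j=1}^∞ x_j²`. -/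
def Jfun (x : ℕ →ᵇ ℝ) : ℝ := x 0 - ∑' j : ℕ, (x (j + 1)) ^ 2

/-- The rate function `I(x) = x_0 − 1 − ln J(x)` for `J(x) > 0`, and `+∞` when `J(x) = 0`. -/
def Ifun (x : ℕ →ᵇ ℝ) : EReal :=
  if 0 < Jfun x then ((x 0 - 1 - Real.log (Jfun x) : ℝ) : EReal) else ⊤

/-- The open Weyl chamber `Σ_n`: strictly decreasing positive vectors. -/
def SigmaN (m : ℕ) : Set (Fin m → ℝ) :=
  {μ | (∀ i j : Fin m, i < j → μ j < μ i) ∧ ∀ i, 0 < μ i}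

/-- The Vandermonde-type determinant `Δ(μ) = ∏_{i<j} (μ_i² − μ_j²)`. -/
def VdM (m : ℕ) (μ : Fin m → ℝ) : ℝ :=
  ∏ p ∈ Finset.univ.filter (fun p : Fin m × Fin m => p.1 < p.2), (μ p.1 ^ 2 - μ p.2 ^ 2)

/-- The normalization constant `Z_n = (π/2)^{n/4} ∏_{j=0}^{n/2−1} (2j)!`. -/
def Zn (n : ℕ) : ℝ :=
  (Real.pi / 2) ^ ((n : ℝ) / 4) * ∏ j ∈ Finset.range (n / 2), (Nat.factorial (2 * j) : ℝ)

/-- The law of `μ = (μ_1, …, μ_{n/2})`: the probability measure on `ℝ^{n/2}` with density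
`Z_n^{-1} |Δ(μ)|² e^{−Σ μ_j²/2}` on `Σ_{n}` with respect to Lebesgue measure. -/
def Pn (n : ℕ) : Measure (Fin (n / 2) → ℝ) :=
  (volume.restrict (SigmaN (n / 2))).withDensity
    (fun μ => ENNReal.ofReal ((Zn n)⁻¹ * (VdM (n / 2) μ) ^ 2 * Real.exp (-(∑ j, μ j ^ 2) / 2)))

/-- `γ` is the family of random elements `γ_n ∈ X` associated with `μ`:
`(γ_n)_0 = C(n,2)^{-1} Σ_j μ_j²`, `(γ_n)_j = C(n,2)^{-1/2} μ_j` for `1 ≤ j ≤ n/2`, and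
`(γ_n)_j = 0` for `j > n/2` (characterized on `Σ_n`, which has full `Pn`-measure). -/
def IsGammaN (γ : (n : ℕ) → (Fin (n / 2) → ℝ) → (ℕ →ᵇ ℝ)) : Prop :=
  ∀ n : ℕ, Even n → 0 < n → ∀ μ ∈ SigmaN (n / 2),
    γ n μ ∈ setX ∧
    (γ n μ) 0 = (n.choose 2 : ℝ)⁻¹ * ∑ j, μ j ^ 2 ∧
    (∀ j : Fin (n / 2), (γ n μ) ((j : ℕ) + 1) = (Real.sqrt (n.choose 2))⁻¹ * μ j) ∧
    (∀ j : ℕ, n / 2 < j → (γ n μ) j = 0)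

/-! ### Determinants of orthogonal functions -/

section Andreief

variable {ι : Type*} [Fintype ι] [DecidableEq ι] {α : Type*}

lemma det_of_sq_eq_sum (ψ : ι → α → ℝ) (x : ι → α) :
    (Matrix.of fun a i => ψ a (x i)).det ^ 2 =
      ∑ σ : Equiv.Perm ι, ∑ τ : Equiv.Perm ι,
        ((Equiv.Perm.sign σ : ℤ) : ℝ) * ((Equiv.Perm.sign τ : ℤ) : ℝ) *
          ∏ i, (ψ (σ i) (x i) * ψ (τ i) (x i)) := by
  rw [Matrix.det_apply', sq, Finset.sum_mul_sum]
  refine Finset.sum_congr rfl fun σ _ => Finset.sum_congr rfl fun τ _ => ?_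
  rw [Finset.prod_mul_distrib]
  simp only [Matrix.of_apply]
  ring

variable [MeasurableSpace α] {ν : Measure α} [SigmaFinite ν] {ψ : ι → α → ℝ}

lemma integrable_det_of_sq (hψ : ∀ a b, Integrable (fun x => ψ a x * ψ b x) ν) :
    Integrable (fun x : ι → α => (Matrix.of fun a i => ψ a (x i)).det ^ 2)
      (Measure.pi fun _ => ν) := by
  simp only [det_of_sq_eq_sum]
  refine integrable_finsetSum _ fun σ _ => integrable_finsetSum _ fun τ _ => ?_
  exact (Integrable.fintype_prod (f := fun i x => ψ (σ i) x * ψ (τ i) x)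
    fun i => hψ _ _).const_mul _

/-- Andréief's identity for an orthogonal family. -/
lemma integral_det_of_sq (hψ : ∀ a b, Integrable (fun x => ψ a x * ψ b x) ν) {h : ι → ℝ}
    (horth : ∀ a b, ∫ x, ψ a x * ψ b x ∂ν = if a = b then h a else 0) :
    ∫ x : ι → α, (Matrix.of fun a i => ψ a (x i)).det ^ 2 ∂(Measure.pi fun _ => ν) =
      (Fintype.card ι).factorial * ∏ a, h a := by
  have hint : ∀ σ τ : Equiv.Perm ι, Integrable (fun x : ι → α =>
      ((Equiv.Perm.sign σ : ℤ) : ℝ) * ((Equiv.Perm.sign τ : ℤ) : ℝ) *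
        ∏ i, (ψ (σ i) (x i) * ψ (τ i) (x i))) (Measure.pi fun _ => ν) := fun σ τ =>
    (Integrable.fintype_prod (f := fun i x => ψ (σ i) x * ψ (τ i) x)
      fun i => hψ _ _).const_mul _
  have hterm : ∀ σ τ : Equiv.Perm ι, ∫ x : ι → α,
      ((Equiv.Perm.sign σ : ℤ) : ℝ) * ((Equiv.Perm.sign τ : ℤ) : ℝ) *
        ∏ i, (ψ (σ i) (x i) * ψ (τ i) (x i)) ∂(Measure.pi fun _ => ν) =
      if σ = τ then ∏ a, h a else 0 := by
    intro σ τ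
    rw [integral_const_mul, integral_fintype_prod_eq_prod (fun i x => ψ (σ i) x * ψ (τ i) x)]
    simp only [horth]
    split_ifs with hστ
    · subst hστ
      have hsign : ((Equiv.Perm.sign σ : ℤ) : ℝ) * ((Equiv.Perm.sign σ : ℤ) : ℝ) = 1 := by
        rcases Int.units_eq_one_or (Equiv.Perm.sign σ) with hs | hs <;> simp [hs]
      simp only [hsign, if_true, one_mul]
      exact Equiv.prod_comp σ h
    · obtain ⟨i, hi⟩ : ∃ i, σ i ≠ τ i := by
        by_contra! hcon
        exact hστ (Equiv.ext hcon)
      rw [Finset.prod_eq_zero (Finset.mem_univ i) (if_neg hi), mul_zero]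
  simp only [det_of_sq_eq_sum]
  rw [integral_finsetSum _ fun σ _ => integrable_finsetSum _ fun τ _ => hint σ τ]
  simp only [integral_finsetSum _ fun τ _ => hint _ τ, hterm]
  simp [Fintype.card_perm]

end Andreief

/-! ### Orthogonality of the Hermite polynomials -/

open Polynomial in
lemma integrable_eval_mul_gaussian (p : ℝ[X]) :
    Integrable (fun x : ℝ => p.eval x * Real.exp (-(x ^ 2 / 2))) := by
  have hmono : ∀ i : ℕ, Integrable (fun x : ℝ => x ^ i * Real.exp (-(x ^ 2 / 2))) := by
    intro i
    have := integrable_rpow_mul_exp_neg_mul_sq (b := 1 / 2) (by norm_num) (s := i)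
      (by have : (0 : ℝ) ≤ i := i.cast_nonneg
          linarith)
    refine this.congr (ae_of_all _ fun x => ?_)
    simp only [Real.rpow_natCast]
    ring_nf
  simp only [Polynomial.eval_eq_sum_range, Finset.sum_mul, mul_assoc]
  exact integrable_finsetSum _ fun i _ => (hmono i).const_mul _

/-- The `n`-th probabilists' Hermite polynomial with real coefficients. -/
def realHermite (n : ℕ) : Polynomial ℝ := (Polynomial.hermite n).map (Int.castRingHom ℝ)

lemma realHermite_succ (n : ℕ) :
    realHermite (n + 1) =
      Polynomial.X * realHermite n - Polynomial.derivative (realHermite n) := by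
  simp [realHermite, Polynomial.hermite_succ, Polynomial.derivative_map]

lemma monic_realHermite (n : ℕ) : (realHermite n).Monic :=
  (Polynomial.hermite_monic n).map _

lemma natDegree_realHermite (n : ℕ) : (realHermite n).natDegree = n := by
  rw [realHermite, (Polynomial.hermite_monic n).natDegree_map, Polynomial.natDegree_hermite]

open Polynomial in
lemma integral_realHermite_succ_mul (n : ℕ) (p : ℝ[X]) :
    ∫ x : ℝ, (realHermite (n + 1) * p).eval x * Real.exp (-(x ^ 2 / 2)) =
      ∫ x : ℝ, (realHermite n * derivative p).eval x * Real.exp (-(x ^ 2 / 2)) := by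
  have hg : ∀ x : ℝ, HasDerivAt (fun y : ℝ => Real.exp (-(y ^ 2 / 2)))
      (-x * Real.exp (-(x ^ 2 / 2))) x := by
    intro x
    have h1 : HasDerivAt (fun y : ℝ => -(y ^ 2 / 2)) (-x) x :=
      (((hasDerivAt_pow 2 x).div_const 2).neg).congr_deriv (by simp)
    exact h1.exp.congr_deriv (mul_comm _ _)
  have hv : ∀ x : ℝ, HasDerivAt (fun y : ℝ => (realHermite n).eval y * Real.exp (-(y ^ 2 / 2)))
      (-((realHermite (n + 1)).eval x * Real.exp (-(x ^ 2 / 2)))) x := by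
    intro x
    refine (((realHermite n).hasDerivAt x).mul (hg x)).congr_deriv ?_
    rw [realHermite_succ]
    simp only [eval_sub, eval_mul, eval_X]
    ring
  have key := integral_mul_deriv_eq_deriv_mul_of_integrable
    (u := fun x => p.eval x) (u' := fun x => (derivative p).eval x)
    (fun x _ => p.hasDerivAt x) (fun x _ => hv x)
    ((integrable_eval_mul_gaussian (p * realHermite (n + 1))).neg.congr
      (ae_of_all _ fun x => by simp [mul_assoc]))
    ((integrable_eval_mul_gaussian (derivative p * realHermite n)).congr
      (ae_of_all _ fun x => by simp [mul_assoc]))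
    ((integrable_eval_mul_gaussian (p * realHermite n)).congr
      (ae_of_all _ fun x => by simp [mul_assoc]))
  simp only [mul_neg, integral_neg, neg_inj, ← mul_assoc, ← eval_mul] at key
  simpa only [mul_comm p, mul_comm (derivative p)] using key

open Polynomial in
lemma integral_realHermite_mul (n : ℕ) (p : ℝ[X]) :
    ∫ x : ℝ, (realHermite n * p).eval x * Real.exp (-(x ^ 2 / 2)) =
      ∫ x : ℝ, (derivative^[n] p).eval x * Real.exp (-(x ^ 2 / 2)) := by
  induction n generalizing p with
  | zero => simp [realHermite]
  | succ n ih => rw [integral_realHermite_succ_mul, ih, Function.iterate_succ_apply]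

open Polynomial in
lemma integral_realHermite_mul_realHermite (n k : ℕ) :
    ∫ x : ℝ, (realHermite n * realHermite k).eval x * Real.exp (-(x ^ 2 / 2)) =
      if n = k then √(2 * Real.pi) * n.factorial else 0 := by
  have hlt : ∀ n k : ℕ, k < n →
      ∫ x : ℝ, (realHermite n * realHermite k).eval x * Real.exp (-(x ^ 2 / 2)) = 0 := by
    intro n k hkn
    rw [integral_realHermite_mul, iterate_derivative_eq_zero (by rwa [natDegree_realHermite])]
    simp
  split_ifs with hnk
  · subst hnk
    have hder : derivative^[n] (realHermite n) = C (n.factorial : ℝ) := by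
      have hdeg := natDegree_iterate_derivative (realHermite n) n
      rw [natDegree_realHermite, Nat.sub_self, Nat.le_zero] at hdeg
      rw [eq_C_of_natDegree_eq_zero hdeg, coeff_iterate_derivative, zero_add,
        Nat.descFactorial_self]
      have hlead := (monic_realHermite n).coeff_natDegree
      rw [natDegree_realHermite] at hlead
      simp [hlead]
    rw [integral_realHermite_mul, hder]
    simp only [eval_C]
    rw [integral_const_mul, mul_comm]
    congr 1
    have hgauss := integral_gaussian (1 / 2)
    ring_nf at hgauss ⊢
    exact hgauss
  · rcases lt_or_gt_of_ne hnk with h | h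
    · rw [mul_comm (realHermite n), hlt k n h]
    · exact hlt n k h

/-- The polynomial `q` with `q(x²) = He_{2j}(x)`. -/
def evenHermite (j : ℕ) : Polynomial ℝ := Polynomial.contract 2 (realHermite (2 * j))

open Polynomial in
lemma expand_evenHermite (j : ℕ) : expand ℝ 2 (evenHermite j) = realHermite (2 * j) := by
  ext k
  rw [coeff_expand two_pos, evenHermite, coeff_contract two_ne_zero]
  split_ifs with hk
  · rw [Nat.div_mul_cancel hk]
  · have hodd : Odd (2 * j + k) := by
      rw [Nat.odd_add]
      simp [← Nat.not_even_iff_odd, even_iff_two_dvd, hk]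
    simp [realHermite, coeff_hermite_of_odd_add hodd]

lemma natDegree_evenHermite (j : ℕ) : (evenHermite j).natDegree = j := by
  have h := Polynomial.natDegree_expand 2 (evenHermite j)
  rw [expand_evenHermite, natDegree_realHermite] at h
  omega

lemma monic_evenHermite (j : ℕ) : (evenHermite j).Monic := by
  rw [← Polynomial.monic_expand_iff two_pos, expand_evenHermite]
  exact monic_realHermite _

lemma eval_evenHermite_sq (j : ℕ) (x : ℝ) :
    (evenHermite j).eval (x ^ 2) = (realHermite (2 * j)).eval x := by
  rw [← expand_evenHermite, Polynomial.expand_eval]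

/-! ### The partition function -/

lemma VdM_sq (k : ℕ) (μ : Fin k → ℝ) :
    VdM k μ ^ 2 =
      (Matrix.of fun (a : Fin k) i => (realHermite (2 * (a : ℕ))).eval (μ i)).det ^ 2 := by
  have h1 : (Matrix.of fun (a : Fin k) i => (realHermite (2 * (a : ℕ))).eval (μ i)).det =
      (Matrix.vandermonde fun i => μ i ^ 2).det := by
    rw [Matrix.det_eval_matrixOfPolynomials_eq_det_vandermonde (fun i => μ i ^ 2)
      (fun a : Fin k => evenHermite a) (fun a => natDegree_evenHermite a)
      (fun a => monic_evenHermite a), ← Matrix.det_transpose]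
    congr 1
    ext i a
    simp [eval_evenHermite_sq]
  rw [h1, Matrix.det_vandermonde, VdM]
  have h2 : ∏ i : Fin k, ∏ j ∈ Finset.Ioi i, (μ j ^ 2 - μ i ^ 2) =
      ∏ p ∈ Finset.univ.filter (fun p : Fin k × Fin k => p.1 < p.2),
        (μ p.2 ^ 2 - μ p.1 ^ 2) := by
    rw [Finset.prod_filter, ← Finset.univ_product_univ, Finset.prod_product]
    refine Finset.prod_congr rfl fun i _ => ?_
    rw [← Finset.prod_filter]
    refine Finset.prod_congr ?_ fun _ _ => rfl
    ext j
    simp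
  rw [h2, ← Finset.prod_pow, ← Finset.prod_pow]
  exact Finset.prod_congr rfl fun p _ => by ring

/-- Hermite functions of even index. -/
def evenHermiteFun (a : ℕ) (x : ℝ) : ℝ := (realHermite (2 * a)).eval x * Real.exp (-(x ^ 2 / 4))

lemma evenHermiteFun_mul (a b : ℕ) (x : ℝ) :
    evenHermiteFun a x * evenHermiteFun b x =
      (realHermite (2 * a) * realHermite (2 * b)).eval x * Real.exp (-(x ^ 2 / 2)) := by
  have h : Real.exp (-(x ^ 2 / 2)) = Real.exp (-(x ^ 2 / 4)) * Real.exp (-(x ^ 2 / 4)) := by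
    rw [← Real.exp_add]
    ring_nf
  rw [h, Polynomial.eval_mul, evenHermiteFun, evenHermiteFun]
  ring

lemma VdM_sq_mul_exp (k : ℕ) (μ : Fin k → ℝ) :
    VdM k μ ^ 2 * Real.exp (-(∑ j, μ j ^ 2) / 2) =
      (Matrix.of fun (a : Fin k) i => evenHermiteFun a (μ i)).det ^ 2 := by
  have h := Matrix.det_mul_row (fun i : Fin k => Real.exp (-(μ i ^ 2 / 4)))
    (Matrix.of fun (a : Fin k) i => (realHermite (2 * (a : ℕ))).eval (μ i))
  have h' : (Matrix.of fun (a : Fin k) i => evenHermiteFun a (μ i)).det =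
      (∏ i : Fin k, Real.exp (-(μ i ^ 2 / 4))) *
      (Matrix.of fun (a : Fin k) i => (realHermite (2 * (a : ℕ))).eval (μ i)).det := by
    rw [← h]
    congr 1
    ext a i
    simp [evenHermiteFun, mul_comm]
  rw [h', mul_pow, ← VdM_sq, mul_comm, ← Real.exp_sum, ← Real.exp_nat_mul]
  congr 2
  rw [Finset.sum_neg_distrib, ← Finset.sum_div]
  push_cast
  ring

lemma integrable_VdM_sq_mul_exp (k : ℕ) :
    Integrable (fun μ : Fin k → ℝ => VdM k μ ^ 2 * Real.exp (-(∑ j, μ j ^ 2) / 2)) := by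
  simp only [VdM_sq_mul_exp]
  refine integrable_det_of_sq (ψ := fun (a : Fin k) x => evenHermiteFun a x) fun a b => ?_
  simp only [evenHermiteFun_mul]
  exact integrable_eval_mul_gaussian _

lemma integral_VdM_sq_mul_exp (k : ℕ) :
    ∫ μ : Fin k → ℝ, VdM k μ ^ 2 * Real.exp (-(∑ j, μ j ^ 2) / 2) =
      k.factorial * ∏ a : Fin k, (√(2 * Real.pi) * (2 * (a : ℕ)).factorial) := by
  simp only [VdM_sq_mul_exp]
  have := integral_det_of_sq (ν := (volume : Measure ℝ))
    (ψ := fun (a : Fin k) x => evenHermiteFun a x)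
    (h := fun a : Fin k => √(2 * Real.pi) * (2 * (a : ℕ)).factorial)
    (fun a b => by
      simp only [evenHermiteFun_mul]
      exact integrable_eval_mul_gaussian _)
    (fun a b => by
      simp only [evenHermiteFun_mul, integral_realHermite_mul_realHermite]
      have : (2 * (a : ℕ) = 2 * (b : ℕ)) ↔ a = b := by
        rw [Fin.ext_iff]
        omega
      simp only [this])
  rw [Fintype.card_fin] at this
  exact this

lemma card_filter_fst_lt_snd (k : ℕ) :
    (Finset.univ.filter fun p : Fin k × Fin k => p.1 < p.2).card * 2 = k * (k - 1) := by
  have h : (Finset.univ.filter fun p : Fin k × Fin k => p.1 < p.2).card =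
      ∑ i : Fin k, (k - 1 - (i : ℕ)) := by
    rw [Finset.card_filter, ← Finset.univ_product_univ, Finset.sum_product]
    refine Finset.sum_congr rfl fun i _ => ?_
    rw [← Finset.card_filter, ← Fin.card_Ioi]
    congr 1
    ext j
    simp
  rw [h, Fin.sum_univ_eq_sum_range (fun i => k - 1 - i) k, Finset.sum_range_reflect (fun i => i) k,
    Finset.sum_range_id_mul_two]

lemma VdM_smul (k : ℕ) (R : ℝ) (μ : Fin k → ℝ) :
    VdM k (R • μ) = R ^ (k * (k - 1)) * VdM k μ := by
  rw [← card_filter_fst_lt_snd, mul_comm _ 2, pow_mul, VdM, VdM, ← Finset.prod_const,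
    ← Finset.prod_mul_distrib]
  refine Finset.prod_congr rfl fun p _ => ?_
  simp only [Pi.smul_apply, smul_eq_mul]
  ring

lemma VdM_smul_sq_mul_exp (k : ℕ) {R : ℝ} (hR : 0 < R) (μ : Fin k → ℝ) :
    VdM k (R • μ) ^ 2 * Real.exp (-(∑ j, (R • μ) j ^ 2) / (2 * R ^ 2)) =
      R ^ (2 * (k * (k - 1))) * (VdM k μ ^ 2 * Real.exp (-(∑ j, μ j ^ 2) / 2)) := by
  have h : -(∑ j, (R • μ) j ^ 2) / (2 * R ^ 2) = -(∑ j, μ j ^ 2) / 2 := by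
    simp only [Pi.smul_apply, smul_eq_mul, mul_pow, ← Finset.mul_sum]
    field_simp
  rw [h, VdM_smul]
  ring

lemma integrable_VdM_sq_mul_exp_div (k : ℕ) {R : ℝ} (hR : 0 < R) :
    Integrable (fun μ : Fin k → ℝ =>
      VdM k μ ^ 2 * Real.exp (-(∑ j, μ j ^ 2) / (2 * R ^ 2))) := by
  rw [← integrable_comp_smul_iff volume _ hR.ne']
  simp only [VdM_smul_sq_mul_exp k hR]
  exact (integrable_VdM_sq_mul_exp k).const_mul _

lemma integral_VdM_sq_mul_exp_div (k : ℕ) {R : ℝ} (hR : 0 < R) :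
    ∫ μ : Fin k → ℝ, VdM k μ ^ 2 * Real.exp (-(∑ j, μ j ^ 2) / (2 * R ^ 2)) =
      R ^ ((2 * k).choose 2) *
        ∫ μ : Fin k → ℝ, VdM k μ ^ 2 * Real.exp (-(∑ j, μ j ^ 2) / 2) := by
  have h := Measure.integral_comp_smul (volume : Measure (Fin k → ℝ))
    (fun μ => VdM k μ ^ 2 * Real.exp (-(∑ j, μ j ^ 2) / (2 * R ^ 2))) R
  simp only [VdM_smul_sq_mul_exp k hR] at h
  rw [integral_const_mul, Module.finrank_fin_fun, abs_of_pos (by positivity), smul_eq_mul,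
    eq_inv_mul_iff_mul_eq₀ (by positivity), ← mul_assoc, ← pow_add] at h
  have hexp : k + 2 * (k * (k - 1)) = (2 * k).choose 2 := by
    rw [Nat.choose_two_right]
    symm
    apply Nat.div_eq_of_eq_mul_left two_pos
    rcases k with _ | k
    · rfl
    · rw [Nat.add_sub_cancel, show 2 * (k + 1) - 1 = 2 * k + 1 by omega]
      ring
  rw [← h, hexp]

lemma Zn_pos (n : ℕ) : 0 < Zn n := by
  have := Real.pi_pos
  unfold Zn
  positivity

lemma integral_VdM_eq_Zn (k : ℕ) :
    ∫ μ : Fin k → ℝ, VdM k μ ^ 2 * Real.exp (-(∑ j, μ j ^ 2) / 2) =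
      k.factorial * 2 ^ k * Zn (2 * k) := by
  have hpi := Real.pi_pos
  have hsqrt : √(2 * Real.pi) = 2 * √(Real.pi / 2) := by
    rw [show 2 * Real.pi = 2 ^ 2 * (Real.pi / 2) by ring, Real.sqrt_mul (by norm_num),
      Real.sqrt_sq (by norm_num)]
  have hpow : (Real.pi / 2) ^ (((2 * k : ℕ) : ℝ) / 4) = √(Real.pi / 2) ^ k := by
    rw [Real.sqrt_eq_rpow, ← Real.rpow_natCast, ← Real.rpow_mul (by positivity)]
    congr 1
    push_cast
    ring
  rw [integral_VdM_sq_mul_exp, Zn, hpow, Nat.mul_div_cancel_left k two_pos,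
    Finset.prod_mul_distrib, Fin.prod_univ_eq_prod_range (fun a => ((2 * a).factorial : ℝ)),
    Finset.prod_const, Finset.card_univ, Fintype.card_fin, hsqrt, mul_pow]
  ring

/-! ### Tail estimates -/

lemma isOpen_SigmaN (k : ℕ) : IsOpen (SigmaN k) := by
  have h : SigmaN k = (⋂ i : Fin k, ⋂ j : Fin k, ⋂ _ : i < j, {μ | μ j < μ i}) ∩
      ⋂ i : Fin k, {μ | 0 < μ i} := by
    ext μ
    simp [SigmaN]
  rw [h]
  refine IsOpen.inter ?_ (isOpen_iInter_of_finite fun i =>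
    isOpen_lt continuous_const (continuous_apply i))
  exact isOpen_iInter_of_finite fun i => isOpen_iInter_of_finite fun j =>
    isOpen_iInter_of_finite fun _ => isOpen_lt (continuous_apply j) (continuous_apply i)

lemma continuous_VdM (k : ℕ) : Continuous (VdM k) := by
  unfold VdM
  fun_prop

lemma VdM_ne_zero {k : ℕ} {μ : Fin k → ℝ} (hμ : μ ∈ SigmaN k) : VdM k μ ≠ 0 := by
  refine Finset.prod_ne_zero_iff.mpr fun p hp => ?_
  have h1 := hμ.1 p.1 p.2 (Finset.mem_filter.mp hp).2
  have h2 := hμ.2 p.2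
  have h3 : μ p.2 ^ 2 < μ p.1 ^ 2 := pow_lt_pow_left₀ h1 h2.le two_ne_zero
  exact (sub_pos.mpr h3).ne'

lemma Pn_apply (n : ℕ) (A : Set (Fin (n / 2) → ℝ)) :
    Pn n A = ∫⁻ μ in A ∩ SigmaN (n / 2),
      ENNReal.ofReal ((Zn n)⁻¹ * VdM (n / 2) μ ^ 2 * Real.exp (-(∑ j, μ j ^ 2) / 2)) := by
  rw [Pn, withDensity_apply', Measure.restrict_restrict' (isOpen_SigmaN _).measurableSet]

lemma exists_mem_SigmaN_lt {k : ℕ} (hk : 0 < k) (a : ℝ) :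
    ∃ μ ∈ SigmaN k, a < ∑ j, μ j ^ 2 := by
  set R : ℝ := |a| + 1
  have hR1 : 1 ≤ R := by
    have := abs_nonneg a
    linarith
  have hge : ∀ i : Fin k, R ≤ R * ((k : ℝ) - (i : ℕ)) := by
    intro i
    have : ((i : ℕ) : ℝ) + 1 ≤ k := by exact_mod_cast i.2
    exact le_mul_of_one_le_right (by linarith) (by linarith)
  refine ⟨fun i => R * ((k : ℝ) - (i : ℕ)), ⟨fun i j hij => ?_, fun i => ?_⟩, ?_⟩
  · have : ((i : ℕ) : ℝ) < (j : ℕ) := by exact_mod_cast hij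
    exact mul_lt_mul_of_pos_left (by linarith) (by linarith)
  · exact lt_of_lt_of_le (by linarith) (hge i)
  · have h1 : (R * ((k : ℝ) - ((⟨0, hk⟩ : Fin k) : ℕ))) ^ 2 ≤
        ∑ j : Fin k, (R * ((k : ℝ) - (j : ℕ))) ^ 2 :=
      Finset.single_le_sum (f := fun j : Fin k => (R * ((k : ℝ) - (j : ℕ))) ^ 2)
        (fun j _ => sq_nonneg _) (Finset.mem_univ _)
    have h2 := hge ⟨0, hk⟩
    have h3 := le_abs_self a
    nlinarith

/-- Chernoff bound for `∑ μ_j²` under `Pn n`. -/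
lemma Pn_tail_le {n : ℕ} (hn : Even n) {a : ℝ} (ha : 1 ≤ a) {A : Set (Fin (n / 2) → ℝ)}
    (hA : ∀ μ ∈ A ∩ SigmaN (n / 2), a * n.choose 2 ≤ ∑ j, μ j ^ 2) :
    Pn n A ≤ ENNReal.ofReal ((n / 2).factorial * 2 ^ (n / 2) *
      Real.exp (-(n.choose 2 / 2 * (a - 1 - Real.log a)))) := by
  have ha0 : 0 < a := by linarith
  have hR : 0 < √a := Real.sqrt_pos.mpr ha0
  have hZ := Zn_pos n
  have hint := (integrable_VdM_sq_mul_exp_div (n / 2) hR).const_mul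
    ((Zn n)⁻¹ * Real.exp (-((a - 1) * n.choose 2 / 2)))
  have hval : ∫ μ : Fin (n / 2) → ℝ, (Zn n)⁻¹ * Real.exp (-((a - 1) * n.choose 2 / 2)) *
      (VdM (n / 2) μ ^ 2 * Real.exp (-(∑ j, μ j ^ 2) / (2 * √a ^ 2))) =
      (n / 2).factorial * 2 ^ (n / 2) *
        Real.exp (-(n.choose 2 / 2 * (a - 1 - Real.log a))) := by
    have hpow : √a ^ n.choose 2 = Real.exp (n.choose 2 / 2 * Real.log a) := by
      rw [← Real.exp_log hR, ← Real.exp_nat_mul, Real.log_sqrt ha0.le]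
      ring_nf
    rw [integral_const_mul, integral_VdM_sq_mul_exp_div _ hR, integral_VdM_eq_Zn,
      Nat.two_mul_div_two_of_even hn, hpow,
      show -((n.choose 2 : ℝ) / 2 * (a - 1 - Real.log a)) =
        -((a - 1) * n.choose 2 / 2) + n.choose 2 / 2 * Real.log a by ring,
      Real.exp_add]
    field_simp
  rw [Pn_apply, ← hval, ofReal_integral_eq_lintegral_ofReal hint
    (ae_of_all _ fun μ => by positivity)]
  refine le_trans (setLIntegral_mono ?_ fun μ hμ => ?_) (setLIntegral_le_lintegral _ _)
  · have := continuous_VdM (n / 2)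
    fun_prop
  · have hS := hA μ hμ
    rw [show (Zn n)⁻¹ * Real.exp (-((a - 1) * n.choose 2 / 2)) *
        (VdM (n / 2) μ ^ 2 * Real.exp (-(∑ j, μ j ^ 2) / (2 * √a ^ 2))) =
        (Zn n)⁻¹ * VdM (n / 2) μ ^ 2 * (Real.exp (-((a - 1) * n.choose 2 / 2)) *
          Real.exp (-(∑ j, μ j ^ 2) / (2 * √a ^ 2))) by ring, ← Real.exp_add, Real.sq_sqrt ha0.le]
    gcongr
    have hle : (a - 1) * n.choose 2 ≤ (a - 1) * ((∑ j, μ j ^ 2) / a) :=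
      mul_le_mul_of_nonneg_left ((le_div_iff₀ ha0).mpr (by linarith)) (by linarith)
    have hsplit : (a - 1) * ((∑ j, μ j ^ 2) / a) = ∑ j, μ j ^ 2 - (∑ j, μ j ^ 2) / a := by
      field_simp
    have hdiv : -(∑ j, μ j ^ 2) / (2 * a) = -((∑ j, μ j ^ 2) / a) / 2 := by
      field_simp
    rw [hdiv]
    linarith

lemma Pn_pos {n : ℕ} {a : ℝ} (hn : 0 < n / 2) {A : Set (Fin (n / 2) → ℝ)}
    (hA : ∀ μ ∈ SigmaN (n / 2), a < ∑ j, μ j ^ 2 → μ ∈ A) : 0 < Pn n A := by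
  set B : Set (Fin (n / 2) → ℝ) := {μ | a < ∑ j, μ j ^ 2} ∩ SigmaN (n / 2)
  have hBopen : IsOpen B :=
    (isOpen_lt continuous_const (by fun_prop)).inter (isOpen_SigmaN _)
  have hBne : B.Nonempty := by
    obtain ⟨μ, hμ, hlt⟩ := exists_mem_SigmaN_lt hn a
    exact ⟨μ, hlt, hμ⟩
  have hmeas : Measurable fun μ : Fin (n / 2) → ℝ => ENNReal.ofReal
      ((Zn n)⁻¹ * VdM (n / 2) μ ^ 2 * Real.exp (-(∑ j, μ j ^ 2) / 2)) := by
    have := continuous_VdM (n / 2)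
    fun_prop
  have hBA : B ⊆ A := fun μ hμ => hA μ hμ.2 hμ.1
  refine lt_of_lt_of_le ?_ (measure_mono hBA)
  rw [Pn_apply, Set.inter_eq_left.mpr Set.inter_subset_right, setLIntegral_pos_iff hmeas,
    Set.inter_eq_right.mpr]
  · exact hBopen.measure_pos _ hBne
  · intro μ hμ
    have h1 := Zn_pos n
    have h2 := VdM_ne_zero hμ.2
    simp only [Function.mem_support, ne_eq, ENNReal.ofReal_eq_zero, not_le]
    positivity

/-! ### Compactness -/

lemma isCompact_setOf_abs_le {b : ℕ → ℝ} (hb : Tendsto b atTop (nhds 0)) :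
    IsCompact {x : ℕ →ᵇ ℝ | ∀ j, |x j| ≤ b j} := by
  set S : Set (ℕ → ℝ) := Set.univ.pi fun j => Set.Icc (-b j) (b j)
  have hSc : IsCompact S := isCompact_univ_pi fun j => isCompact_Icc
  have hmem : ∀ f : S, ∀ j, |f.1 j| ≤ b j := fun f j => abs_le.mpr (f.2 j (Set.mem_univ j))
  obtain ⟨C, hC⟩ := hb.bddAbove_range
  have hC' : ∀ j, b j ≤ C := fun j => hC ⟨j, rfl⟩
  set Φ : S → (ℕ →ᵇ ℝ) := fun f =>
    BoundedContinuousFunction.ofNormedAddCommGroup f.1 continuous_of_discreteTopology C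
      (fun j => (hmem f j).trans (hC' j))
  have hΦc : Continuous Φ := by
    rw [Metric.continuous_iff']
    intro f ε hε
    have hev : ∀ᶠ j in atTop, b j < ε / 4 := hb.eventually (gt_mem_nhds (by linarith))
    obtain ⟨J, hJ⟩ := eventually_atTop.mp hev
    have hfin : ∀ᶠ g : S in nhds f, ∀ j ∈ Finset.range J, dist (g.1 j) (f.1 j) < ε / 2 := by
      rw [Filter.eventually_all_finset]
      intro j _
      have hcont : Continuous fun g : S => g.1 j := (continuous_apply j).comp continuous_subtype_val
      exact hcont.continuousAt.eventually (Metric.ball_mem_nhds _ (by linarith))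
    filter_upwards [hfin] with g hg
    refine lt_of_le_of_lt ((BoundedContinuousFunction.dist_le (C := ε / 2) (by linarith)).mpr
      fun j => ?_) (by linarith)
    change dist (g.1 j) (f.1 j) ≤ ε / 2
    by_cases hj : j < J
    · exact (hg j (Finset.mem_range.mpr hj)).le
    · have h1 := hJ j (not_lt.mp hj)
      have h2 := hmem g j
      have h3 := hmem f j
      rw [Real.dist_eq]
      have h4 := abs_sub (g.1 j) (f.1 j)
      linarith
  have himage : {x : ℕ →ᵇ ℝ | ∀ j, |x j| ≤ b j} = Set.range Φ := by
    ext x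
    constructor
    · intro hx
      refine ⟨⟨fun j => x j, fun j _ => abs_le.mp (hx j)⟩, ?_⟩
      ext j
      rfl
    · rintro ⟨f, rfl⟩ j
      exact hmem f j
  rw [himage]
  have : CompactSpace S := isCompact_iff_compactSpace.mp hSc
  exact isCompact_range hΦc

lemma memX_iff (x : ℕ →ᵇ ℝ) :
    memX x ↔ (∀ j : ℕ, 1 ≤ j → 0 ≤ x (j + 1) ∧ x (j + 1) ≤ x j) ∧
      ∀ n : ℕ, ∑ j ∈ Finset.range n, x (j + 1) ^ 2 ≤ x 0 := by
  refine and_congr_right fun _ => ⟨fun h n => ?_, fun h => ?_⟩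
  · exact (h.1.sum_le_tsum _ fun j _ => sq_nonneg _).trans h.2
  · exact ⟨summable_of_sum_range_le (fun j => sq_nonneg _) h,
      Real.tsum_le_of_sum_range_le (fun j => sq_nonneg _) h⟩

lemma isClosed_setX : IsClosed setX := by
  have hev : ∀ j : ℕ, Continuous fun x : ℕ →ᵇ ℝ => x j := fun j => continuous_eval_const j
  have h : setX = (⋂ j : ℕ, ⋂ _ : 1 ≤ j, ({x : ℕ →ᵇ ℝ | 0 ≤ x (j + 1)} ∩ {x | x (j + 1) ≤ x j})) ∩
      ⋂ n : ℕ, {x : ℕ →ᵇ ℝ | ∑ j ∈ Finset.range n, x (j + 1) ^ 2 ≤ x 0} := by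
    ext x
    simp [setX, memX_iff]
  rw [h]
  refine IsClosed.inter ?_ (isClosed_iInter fun n => isClosed_le
    (continuous_finsetSum _ fun j _ => (hev (j + 1)).pow 2) (hev 0))
  exact isClosed_iInter fun j => isClosed_iInter fun _ =>
    (isClosed_le continuous_const (hev _)).inter (isClosed_le (hev _) (hev _))

lemma abs_le_of_memX {x : ℕ →ᵇ ℝ} (hx : memX x) (j : ℕ) : |x (j + 1)| ≤ √(x 0 / (j + 1)) := by
  rw [memX_iff] at hx
  have hnonneg : ∀ i : ℕ, 0 ≤ x (i + 1) := by
    rintro (_ | i)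
    · exact (hx.1 1 le_rfl).1.trans (hx.1 1 le_rfl).2
    · exact (hx.1 (i + 1) (by omega)).1
  have hanti : Antitone fun i : ℕ => x (i + 1) :=
    antitone_nat_of_succ_le fun i => (hx.1 (i + 1) (by omega)).2
  have hsum : ((j : ℝ) + 1) * x (j + 1) ^ 2 ≤ x 0 := by
    refine le_trans ?_ (hx.2 (j + 1))
    have := Finset.card_nsmul_le_sum (Finset.range (j + 1)) (fun i => x (i + 1) ^ 2)
      (x (j + 1) ^ 2) fun i hi => pow_le_pow_left₀ (hnonneg j)
        (hanti (Nat.lt_succ_iff.mp (Finset.mem_range.mp hi))) 2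
    simpa using this
  apply Real.abs_le_sqrt
  rw [le_div_iff₀ (by positivity)]
  linarith

lemma isCompact_setX_le (a : ℝ) : IsCompact {x : ℕ →ᵇ ℝ | x ∈ setX ∧ x 0 ≤ a} := by
  set b : ℕ → ℝ := fun j => if j = 0 then a else √(a / j) with hb
  have hlim : Tendsto b atTop (nhds 0) := by
    have h1 : Tendsto (fun j : ℕ => √(a / j)) atTop (nhds 0) := by
      rw [← Real.sqrt_zero]
      exact (Real.continuous_sqrt.tendsto 0).comp (tendsto_const_div_atTop_nhds_zero_nat a)
    refine h1.congr' ?_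
    filter_upwards [eventually_ne_atTop 0] with j hj
    simp [hb, hj]
  have hle : IsClosed {x : ℕ →ᵇ ℝ | x 0 ≤ a} :=
    isClosed_le (continuous_eval_const 0) continuous_const
  have hclosed : IsClosed {x : ℕ →ᵇ ℝ | x ∈ setX ∧ x 0 ≤ a} := isClosed_setX.inter hle
  refine (isCompact_setOf_abs_le hlim).of_isClosed_subset hclosed ?_
  rintro x ⟨hx, hxa⟩ (_ | j)
  · have h0 : 0 ≤ x 0 := by simpa using ((memX_iff x).mp hx).2 0
    simpa [hb, abs_of_nonneg h0] using hxa
  · refine (abs_le_of_memX hx j).trans ?_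
    simp only [hb, Nat.succ_ne_zero, if_false]
    push_cast
    gcongr

/-! ### Exponential tightness -/

/-- Upper bound for the normalized logarithm of a tail probability, where `c` is the decay rate. -/
def tailRate (c : ℝ) (m : ℕ) : ℝ := Real.log m / m + Real.log 2 / m - (1 - 1 / 2 / m) * c

lemma tendsto_tailRate (c : ℝ) : Tendsto (tailRate c) atTop (nhds (-c)) := by
  have h1 : Tendsto (fun m : ℕ => Real.log m / m) atTop (nhds 0) :=
    Real.isLittleO_log_id_atTop.tendsto_div_nhds_zero.comp tendsto_natCast_atTop_atTop
  have h2 := tendsto_const_div_atTop_nhds_zero_nat (Real.log 2)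
  have h3 := ((tendsto_const_div_atTop_nhds_zero_nat (1 / 2 : ℝ)).const_sub 1).mul_const c
  have h := (h1.add h2).sub h3
  simp only [sub_zero, add_zero, one_mul, zero_sub] at h
  exact h

lemma log_le_tailRate {m : ℕ} (hm : 0 < m) {c p : ℝ} (hp : 0 < p)
    (hle : p ≤ m.factorial * 2 ^ m * Real.exp (-((2 * m).choose 2 / 2 * c))) :
    4 / (2 * m : ℝ) ^ 2 * Real.log p ≤ tailRate c m := by
  have hm' : (0 : ℝ) < m := by exact_mod_cast hm
  have hfac : Real.log m.factorial ≤ m * Real.log m := by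
    rw [← Real.log_pow]
    refine Real.log_le_log (by exact_mod_cast m.factorial_pos) ?_
    exact_mod_cast m.factorial_le_pow
  have hchoose : ((2 * m).choose 2 : ℝ) = m * (2 * m - 1) := by
    rw [Nat.cast_choose_two]
    push_cast
    ring
  have hlog : Real.log p ≤ m * Real.log m + m * Real.log 2 - m * (2 * m - 1) / 2 * c := by
    refine (Real.log_le_log hp hle).trans ?_
    have hf : (m.factorial : ℝ) ≠ 0 := by exact_mod_cast m.factorial_ne_zero
    rw [Real.log_mul (by positivity) (Real.exp_ne_zero _), Real.log_mul hf (by positivity),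
      Real.log_exp, Real.log_pow, hchoose]
    linarith
  calc 4 / (2 * m : ℝ) ^ 2 * Real.log p
      ≤ 4 / (2 * m : ℝ) ^ 2 *
          (m * Real.log m + m * Real.log 2 - m * (2 * m - 1) / 2 * c) := by gcongr
    _ = tailRate c m := by
      rw [tailRate]
      field_simp
      ring

theorem stmt16 (γ : (n : ℕ) → (Fin (n / 2) → ℝ) → (ℕ →ᵇ ℝ)) (hγ : IsGammaN γ)
    (E : ℝ) (hE : 0 < E) :
    ∃ K : Set (ℕ →ᵇ ℝ), K = {x : ℕ →ᵇ ℝ | x ∈ setX ∧ x 0 ≤ 2 * (E + 1)} ∧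
      IsCompact K ∧
      Filter.limsup (fun m : ℕ =>
          (((4 / (2 * m : ℝ) ^ 2) *
            Real.log ((Pn (2 * m) {μ | γ (2 * m) μ ∉ K}).toReal) : ℝ) : EReal))
        Filter.atTop < ((-E : ℝ) : EReal) := by
  refine ⟨_, rfl, isCompact_setX_le _, ?_⟩
  set a : ℝ := 2 * (E + 1) with ha
  set c : ℝ := a - 1 - Real.log a with hc
  have hEc : E < c := by
    have h1 : Real.log a = Real.log 2 + Real.log (E + 1) :=
      Real.log_mul two_ne_zero (by linarith)
    have h2 := Real.log_le_sub_one_of_pos (show 0 < E + 1 by linarith)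
    have h3 := Real.log_two_lt_d9
    linarith
  have hlim : Tendsto (fun m : ℕ => ((tailRate c m : ℝ) : EReal)) atTop
      (nhds ((-c : ℝ) : EReal)) :=
    (continuous_coe_real_ereal.tendsto _).comp (tendsto_tailRate c)
  refine lt_of_le_of_lt ?_ (EReal.coe_lt_coe_iff.mpr (neg_lt_neg hEc))
  rw [← hlim.limsup_eq]
  refine limsup_le_limsup ?_
  filter_upwards [eventually_gt_atTop 0] with m hm
  have hchoose : (0 : ℝ) < (2 * m).choose 2 := by
    exact_mod_cast Nat.choose_pos (by omega)
  have hmem : ∀ μ ∈ SigmaN (2 * m / 2),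
      μ ∈ {μ | γ (2 * m) μ ∉ {x : ℕ →ᵇ ℝ | x ∈ setX ∧ x 0 ≤ a}} ↔
        a * (2 * m).choose 2 < ∑ j, μ j ^ 2 := by
    intro μ hμ
    obtain ⟨hX, h0, -⟩ := hγ (2 * m) (even_two_mul m) (by omega) μ hμ
    change ¬ (_ ∧ _) ↔ _
    rw [h0, not_and, not_le, ← div_eq_inv_mul, lt_div_iff₀ hchoose]
    exact ⟨fun h => h hX, fun h _ => h⟩
  have hpos := Pn_pos (by omega) fun μ hμ => (hmem μ hμ).mpr
  have hle := Pn_tail_le (even_two_mul m) (show 1 ≤ a by linarith)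
    fun μ hμ => ((hmem μ hμ.2).mp hμ.1).le
  have hne := ne_top_of_le_ne_top ENNReal.ofReal_ne_top hle
  rw [EReal.coe_le_coe_iff]
  refine log_le_tailRate hm (ENNReal.toReal_pos hpos.ne' hne) ?_
  exact (ENNReal.toReal_le_of_le_ofReal (by positivity) hle).trans_eq
    (by rw [Nat.mul_div_cancel_left m two_pos])
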